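/- Fix a > 0, f > 0, λ > 0, β > 0. Define L(m, ρ) = ρ·(exp(a·m/ρ) − 1)/f − λ·m + β·ρ for 0 < ρ ≤ 1 and m ≥ 0, together with L(0, 0) = 0, and set o(λ, β) = max(λ/a − 1/f, 0) − (λ/a)·max(ln(λ·f/a), 0) + β. Then the infimum of L over its domain {(m, ρ) : 0 < ρ ≤ 1, m ≥ 0} ∪ {(0, 0)} equals min(o(λ, β), 0); if o(λ, β) < 0 this infimum is attained at ρ = 1 and m = (1/a)·max(ln(λ·f/a), 0), and if o(λ, β) ≥ 0 it is attained at (m, ρ) = (0, 0). -/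

import Mathlib

/-- The value of `s ↦ (exp s - 1) / f` at `s = max (log (c * f)) 0`, in closed form. -/
lemma exp_max_log_sub_one_div {c f : ℝ} (hc : 0 < c) (hf : 0 < f) :
    (Real.exp (max (Real.log (c * f)) 0) - 1) / f = max (c - 1 / f) 0 := by
  have hcf : 0 < c * f := mul_pos hc hf
  rcases le_total 1 (c * f) with h | h
  · have h' : 1 / f ≤ c := (div_le_iff₀ hf).2 h
    rw [max_eq_left (Real.log_nonneg h), Real.exp_log hcf, max_eq_left (sub_nonneg.2 h')]
    field_simp
  · have h' : c ≤ 1 / f := (le_div_iff₀ hf).2 h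
    rw [max_eq_right (Real.log_nonpos hcf.le h), max_eq_right (sub_nonpos.2 h')]
    simp

/-- On `s ≥ 0`, the convex function `s ↦ (exp s - 1) / f - c * s` is minimal at
`s = max (log (c * f)) 0`. -/
lemma max_sub_mul_max_log_le {c f s : ℝ} (hc : 0 < c) (hf : 0 < f) (hs : 0 ≤ s) :
    max (c - 1 / f) 0 - c * max (Real.log (c * f)) 0 ≤ (Real.exp s - 1) / f - c * s := by
  rw [← exp_max_log_sub_one_div hc hf]
  set t := max (Real.log (c * f)) 0 with ht
  have hcf : 0 < c * f := mul_pos hc hf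
  have tangent : Real.exp t * (s - t + 1) ≤ Real.exp s := by
    calc Real.exp t * (s - t + 1) ≤ Real.exp t * Real.exp (s - t) := by
          gcongr; exact Real.add_one_le_exp _
      _ = Real.exp s := by rw [← Real.exp_add]; ring_nf
  have slope : c * f * (s - t) ≤ Real.exp t * (s - t) := by
    rcases le_total 1 (c * f) with h | h
    · rw [ht, max_eq_left (Real.log_nonneg h), Real.exp_log hcf]
    · rw [ht, max_eq_right (Real.log_nonpos hcf.le h), Real.exp_zero, sub_zero]
      gcongr
  have key : c * (s - t) ≤ (Real.exp s - Real.exp t) / f := by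
    rw [le_div_iff₀ hf]
    linarith
  have split : (Real.exp s - Real.exp t) / f = (Real.exp s - 1) / f - (Real.exp t - 1) / f := by
    ring
  linarith

/-- For fixed a, f, λ, β > 0, the infimum of
L(m, ρ) = ρ·(exp(a·m/ρ) − 1)/f − λ·m + β·ρ over {(m,ρ) : 0 < ρ ≤ 1, m ≥ 0} ∪ {(0,0)}
(with L(0,0) = 0) equals min(o(λ,β), 0) where
o(λ,β) = max(λ/a − 1/f, 0) − (λ/a)·max(ln(λf/a), 0) + β; if o(λ,β) < 0 the
infimum is attained at ρ = 1, m = (1/a)·max(ln(λf/a), 0), and if o(λ,β) ≥ 0 it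
is attained at (m, ρ) = (0, 0). -/
theorem per_pair_lagrangian_min (a f lam β : ℝ)
    (ha : 0 < a) (hf : 0 < f) (hlam : 0 < lam) (hβ : 0 < β) :
    sInf {y : ℝ |
        (∃ m ρ : ℝ, 0 < ρ ∧ ρ ≤ 1 ∧ 0 ≤ m ∧
          y = ρ * (Real.exp (a * m / ρ) - 1) / f - lam * m + β * ρ) ∨ y = 0}
      = min (max (lam / a - 1 / f) 0 - lam / a * max (Real.log (lam * f / a)) 0 + β) 0 ∧
    (max (lam / a - 1 / f) 0 - lam / a * max (Real.log (lam * f / a)) 0 + β < 0 →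
      1 * (Real.exp (a * (1 / a * max (Real.log (lam * f / a)) 0) / 1) - 1) / f
          - lam * (1 / a * max (Real.log (lam * f / a)) 0) + β * 1
        = min (max (lam / a - 1 / f) 0 - lam / a * max (Real.log (lam * f / a)) 0 + β) 0) ∧
    (0 ≤ max (lam / a - 1 / f) 0 - lam / a * max (Real.log (lam * f / a)) 0 + β →
      min (max (lam / a - 1 / f) 0 - lam / a * max (Real.log (lam * f / a)) 0 + β) 0
        = 0) := by
  have hc : 0 < lam / a := div_pos hlam ha
  rw [show lam * f / a = lam / a * f by ring]
  set o := max (lam / a - 1 / f) 0 - lam / a * max (Real.log (lam / a * f)) 0 + β with ho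
  have attained : 1 * (Real.exp (a * (1 / a * max (Real.log (lam / a * f)) 0) / 1) - 1) / f
      - lam * (1 / a * max (Real.log (lam / a * f)) 0) + β * 1 = o := by
    rw [ho, ← exp_max_log_sub_one_div hc hf, div_one, ← mul_assoc a, mul_one_div_cancel ha.ne']
    ring_nf
  refine ⟨IsLeast.csInf_eq ⟨?_, ?_⟩, fun h => attained.trans (min_eq_left h.le).symm,
    fun h => min_eq_right h⟩
  · rcases le_total o 0 with h | h
    · rw [min_eq_left h]
      exact Or.inl ⟨_, 1, one_pos, le_rfl, by positivity, attained.symm⟩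
    · exact Or.inr (min_eq_right h)
  · rintro y (⟨m, ρ, hρ, hρ1, hm, rfl⟩ | rfl)
    · have hs : 0 ≤ a * m / ρ := by positivity
      have perspective : ρ * (Real.exp (a * m / ρ) - 1) / f - lam * m + β * ρ
          = ρ * ((Real.exp (a * m / ρ) - 1) / f - lam / a * (a * m / ρ) + β) := by
        field_simp
      rw [perspective]
      calc min o 0 ≤ ρ * o := by
            rcases le_total o 0 with h | h
            · exact (min_le_left _ _).trans (by nlinarith)
            · exact (min_le_right _ _).trans (mul_nonneg hρ.le h)
        _ ≤ _ := by
            gcongr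
            linarith [max_sub_mul_max_log_le hc hf hs]
    · exact min_le_right _ _
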